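/- arXiv:2503.08303 — 5 statements merged into one kernel-verified Lean document; each statement's English description precedes it below -/
import Mathlib

section
/- Let Ω_s be a finite set (of physical spin configurations) with an energy function H_e : Ω_s → ℝ, let Ω_cc ⊆ Ω_s be a subset (the chain-consistent configurations), let Ω_p be a finite nonempty set (of logical configurations) with an energy function H_p : Ω_p → ℝ, and suppose ψ : Ω_cc → Ω_p is a bijection such that for some constant Λ ∈ ℝ, H_e(s) = H_p(ψ(s)) − Λ for all s ∈ Ω_cc. Fix β_eff > 0 and let μ be the Gibbs distribution on Ω_s given by μ(s) = e^{−β_eff·H_e(s)} / Σ_{s′ ∈ Ω_s} e^{−β_eff·H_e(s′)}. Let Ω_p^min be the set of minimizers of H_p on Ω_p, let P_cc = μ(Ω_cc), and let P_solve(β_eff) = (Σ_{x ∈ Ω_p^min} e^{−β_eff·H_p(x)}) / (Σ_{x ∈ Ω_p} e^{−β_eff·H_p(x)}). Then μ({s ∈ Ω_cc : ψ(s) ∈ Ω_p^min}) = P_cc · P_solve(β_eff). -/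
open scoped Classical
open Finset Real

/-- Boltzmann weights transported along a bijection that shifts the energy by a constant: the
total weight of the configurations whose image satisfies `p` is a constant multiple of the total
weight of the logical configurations satisfying `p`. -/
theorem sum_filter_exp_comp_bijOn {α γ : Type*} [Fintype γ] {E : α → ℝ} {F : γ → ℝ}
    {S : Finset α} {ψ : α → γ} (hψ : Set.BijOn ψ ↑S Set.univ) {c : ℝ}
    (hE : ∀ s ∈ S, E s = F (ψ s) - c) (b : ℝ) (p : γ → Prop) [DecidablePred p] :
    ∑ s ∈ S.filter (fun s => p (ψ s)), Real.exp (-b * E s) =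
      Real.exp (b * c) * ∑ x ∈ Finset.univ.filter p, Real.exp (-b * F x) := by
  rw [Finset.mul_sum]
  refine Finset.sum_nbij ψ (fun s hs => by simpa using (Finset.mem_filter.1 hs).2)
    (hψ.injOn.mono fun s hs => (Finset.mem_filter.1 hs).1) (fun x hx => ?_) (fun s hs => ?_)
  · obtain ⟨s, hs, rfl⟩ := hψ.surjOn (Set.mem_univ x)
    exact ⟨s, Finset.mem_filter.2 ⟨hs, (Finset.mem_filter.1 hx).2⟩, rfl⟩
  · rw [hE s (Finset.mem_filter.1 hs).1, ← Real.exp_add]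
    ring_nf

/-- **Decomposition of the sparse-solver solution probability.**
If `ψ` is a bijection from the chain-consistent configurations `Ωcc` onto the
logical configuration space `Ωp` with `He s = Hp (ψ s) - Λ` on `Ωcc`, then under
the Gibbs distribution at inverse temperature `βeff` on `Ωs`, the probability of
a chain-consistent configuration mapping to a minimizer of `Hp` equals the chain
consistency probability times the Gibbs probability of minimizers of `Hp`. -/
theorem solve_probability_decomposition
    {Ωs Ωp : Type*} [Fintype Ωs] [Fintype Ωp] [Nonempty Ωp]
    (He : Ωs → ℝ) (Hp : Ωp → ℝ) (Ωcc : Finset Ωs) (ψ : Ωs → Ωp)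
    (hψ : Set.BijOn ψ ↑Ωcc Set.univ)
    (Λ : ℝ) (hΛ : ∀ s ∈ Ωcc, He s = Hp (ψ s) - Λ)
    (βeff : ℝ) (hβ : 0 < βeff) :
    (∑ s ∈ Ωcc.filter (fun s => ∀ y, Hp (ψ s) ≤ Hp y), Real.exp (-βeff * He s)) /
        (∑ s, Real.exp (-βeff * He s)) =
      ((∑ s ∈ Ωcc, Real.exp (-βeff * He s)) / (∑ s, Real.exp (-βeff * He s))) *
        ((∑ x ∈ Finset.univ.filter (fun x => ∀ y, Hp x ≤ Hp y),
            Real.exp (-βeff * Hp x)) /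
          (∑ x, Real.exp (-βeff * Hp x))) := by
  have hZ : (∑ x, Real.exp (-βeff * Hp x)) ≠ 0 :=
    (Finset.sum_pos (fun x _ => Real.exp_pos _) Finset.univ_nonempty).ne'
  have hcc := sum_filter_exp_comp_bijOn hψ hΛ βeff (fun _ => True)
  simp only [Finset.filter_true] at hcc
  rw [sum_filter_exp_comp_bijOn hψ hΛ βeff (fun x => ∀ y, Hp x ≤ Hp y), hcc]
  field_simp
end

section
/- Write Z_{σ₁σ₂} for the sum of e^{−β_eff·H_e^λ(s)} over all configurations with s₁ = σ₁ and s₂ = σ₂ (the x and y spins ranging freely over {−1,+1}). Then Z_{++} = e^{β_eff·λ}·(2·cosh z)^l·2^l, Z_{−−} = e^{β_eff·λ}·2^l·(2·cosh z)^l, Z_{+−} = e^{−β_eff·λ}·(2·cosh z)^{2l}, and Z_{−+} = e^{−β_eff·λ}·2^{2l}; consequently the full partition function is Z = 2·e^{β_eff·λ}·(2·cosh z)^l·2^l + e^{−β_eff·λ}·((2·cosh z)^{2l} + 2^{2l}). -/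
open Finset Real

/-- Spin value of a boolean: `true ↦ +1`, `false ↦ -1`. -/
noncomputable def spin (b : Bool) : ℝ := if b then 1 else -1

/-- The embedded star Hamiltonian
`H_e^λ = -λ·s₁·s₂ + (s₁+1)·(x₁+⋯+x_l) + (s₂-1)·(y₁+⋯+y_l)` on configurations
`σ = (s₁, s₂, x, y)`. -/
noncomputable def He (l : ℕ) (lam : ℝ)
    (σ : Bool × Bool × (Fin l → Bool) × (Fin l → Bool)) : ℝ :=
  -lam * spin σ.1 * spin σ.2.1 + (spin σ.1 + 1) * (∑ i, spin (σ.2.2.1 i)) +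
    (spin σ.2.1 - 1) * (∑ i, spin (σ.2.2.2 i))

/-- The partition function of `l` free spins in a uniform field. -/
lemma sum_exp_mul_sum_spin (l : ℕ) (c : ℝ) :
    ∑ x : Fin l → Bool, Real.exp (c * ∑ i, spin (x i)) = (2 * Real.cosh c) ^ l := by
  have hc : ∑ b : Bool, Real.exp (c * spin b) = 2 * Real.cosh c := by
    rw [Fintype.sum_bool, Real.cosh_eq]
    simp only [spin, if_true, Bool.false_eq_true, if_false, mul_one, mul_neg]
    ring
  simp_rw [Finset.mul_sum, Real.exp_sum]
  rw [← hc, Fintype.sum_pow]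

/-- The partition function of the star Hamiltonian restricted to fixed values of the two
central spins. -/
lemma sum_exp_He (l : ℕ) (lam β : ℝ) (a b : Bool) :
    ∑ xy : (Fin l → Bool) × (Fin l → Bool), Real.exp (-β * He l lam (a, b, xy.1, xy.2)) =
      Real.exp (β * lam * spin a * spin b) * (2 * Real.cosh (β * (spin a + 1))) ^ l *
        (2 * Real.cosh (β * (spin b - 1))) ^ l := by
  rw [← Real.cosh_neg (β * (spin a + 1)), ← Real.cosh_neg (β * (spin b - 1)),
    ← sum_exp_mul_sum_spin, ← sum_exp_mul_sum_spin, mul_assoc, Finset.sum_mul_sum,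
    Finset.mul_sum, Fintype.sum_prod_type]
  refine Finset.sum_congr rfl fun x _ => ?_
  rw [Finset.mul_sum]
  refine Finset.sum_congr rfl fun y _ => ?_
  rw [← Real.exp_add, ← Real.exp_add, He]
  congr 1
  ring

/-- **Branch partition functions of the embedded star Hamiltonian.**
With `z = 2·βeff`:
`Z₊₊ = e^{βeff·λ}·(2 cosh z)^l·2^l`, `Z₋₋ = e^{βeff·λ}·2^l·(2 cosh z)^l`,
`Z₊₋ = e^{-βeff·λ}·(2 cosh z)^{2l}`, `Z₋₊ = e^{-βeff·λ}·2^{2l}`, and the full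
partition function is
`Z = 2·e^{βeff·λ}·(2 cosh z)^l·2^l + e^{-βeff·λ}·((2 cosh z)^{2l} + 2^{2l})`. -/
theorem star_partition_branches (l : ℕ) (hl : 1 ≤ l) (lam βeff : ℝ)
    (hlam : 0 < lam) (hβ : 0 < βeff) (z : ℝ) (hz : z = 2 * βeff) :
    (∑ xy : (Fin l → Bool) × (Fin l → Bool),
        Real.exp (-βeff * He l lam (true, true, xy.1, xy.2)) =
      Real.exp (βeff * lam) * (2 * Real.cosh z) ^ l * 2 ^ l) ∧
    (∑ xy : (Fin l → Bool) × (Fin l → Bool),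
        Real.exp (-βeff * He l lam (false, false, xy.1, xy.2)) =
      Real.exp (βeff * lam) * 2 ^ l * (2 * Real.cosh z) ^ l) ∧
    (∑ xy : (Fin l → Bool) × (Fin l → Bool),
        Real.exp (-βeff * He l lam (true, false, xy.1, xy.2)) =
      Real.exp (-(βeff * lam)) * (2 * Real.cosh z) ^ (2 * l)) ∧
    (∑ xy : (Fin l → Bool) × (Fin l → Bool),
        Real.exp (-βeff * He l lam (false, true, xy.1, xy.2)) =
      Real.exp (-(βeff * lam)) * 2 ^ (2 * l)) ∧
    (∑ σ : Bool × Bool × (Fin l → Bool) × (Fin l → Bool),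
        Real.exp (-βeff * He l lam σ) =
      2 * Real.exp (βeff * lam) * (2 * Real.cosh z) ^ l * 2 ^ l +
        Real.exp (-(βeff * lam)) * ((2 * Real.cosh z) ^ (2 * l) + 2 ^ (2 * l))) := by
  have htt := sum_exp_He l lam βeff true true
  have hff := sum_exp_He l lam βeff false false
  have htf := sum_exp_He l lam βeff true false
  have hft := sum_exp_He l lam βeff false true
  have ht : spin true = 1 := by simp [spin]
  have hf : spin false = -1 := by simp [spin]
  have hup : βeff * (1 + 1) = z := by rw [hz]; ring
  have hdown : βeff * (-1 - 1) = -z := by rw [hz]; ring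
  simp only [ht, hf, hup, hdown, Real.cosh_neg, sub_self, neg_add_cancel, mul_zero,
    Real.cosh_zero, mul_one, mul_neg, neg_neg] at htt hff htf hft
  have hsum : ∑ σ : Bool × Bool × (Fin l → Bool) × (Fin l → Bool),
      Real.exp (-βeff * He l lam σ) = ∑ a : Bool, ∑ b : Bool,
        ∑ xy : (Fin l → Bool) × (Fin l → Bool),
          Real.exp (-βeff * He l lam (a, b, xy.1, xy.2)) := by
    rw [Fintype.sum_prod_type]
    exact Finset.sum_congr rfl fun a _ => Fintype.sum_prod_type _
  rw [hsum]
  simp only [Fintype.sum_bool]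
  rw [htt, hff, htf, hft]
  refine ⟨rfl, rfl, ?_, ?_, ?_⟩ <;> ring
end

section
/- The minimum of the star Hamiltonian over all 2^{2l+1} configurations equals −2·l, and the minimizers are exactly the configurations with either (s_c = +1 and x_i = −1 for all i, the y-spins arbitrary) or (s_c = −1 and y_i = +1 for all i, the x-spins arbitrary); in particular there are exactly 2^{l+1} minimizers. -/
open scoped Classical
open Finset Real

/-- The star Hamiltonian
`H_star = (1 + s_c)·(x₁+⋯+x_l) - (1 - s_c)·(y₁+⋯+y_l)` on configurations
`σ = (s_c, x, y)`. -/
noncomputable def Hstar (l : ℕ) (σ : Bool × (Fin l → Bool) × (Fin l → Bool)) : ℝ :=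
  (1 + spin σ.1) * (∑ i, spin (σ.2.1 i)) - (1 - spin σ.1) * (∑ i, spin (σ.2.2 i))

lemma neg_one_le_spin (b : Bool) : -1 ≤ spin b := by
  cases b <;> norm_num [spin]

lemma spin_le_one (b : Bool) : spin b ≤ 1 := by
  cases b <;> norm_num [spin]

lemma spin_eq_neg_one_iff (b : Bool) : spin b = -1 ↔ b = false := by
  cases b <;> norm_num [spin]

lemma spin_eq_one_iff (b : Bool) : spin b = 1 ↔ b = true := by
  cases b <;> norm_num [spin]

lemma neg_le_sum_spin {l : ℕ} (x : Fin l → Bool) : -(l : ℝ) ≤ ∑ i, spin (x i) := by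
  simpa using Finset.sum_le_sum fun i (_ : i ∈ univ) => neg_one_le_spin (x i)

lemma sum_spin_le {l : ℕ} (x : Fin l → Bool) : ∑ i, spin (x i) ≤ (l : ℝ) := by
  simpa using Finset.sum_le_sum fun i (_ : i ∈ univ) => spin_le_one (x i)

lemma sum_spin_eq_neg_iff {l : ℕ} (x : Fin l → Bool) :
    ∑ i, spin (x i) = -(l : ℝ) ↔ ∀ i, x i = false := by
  have h := Finset.sum_eq_sum_iff_of_le fun i (_ : i ∈ univ) => neg_one_le_spin (x i)
  rw [eq_comm]
  simpa [eq_comm (a := (-1 : ℝ)), spin_eq_neg_one_iff] using h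

lemma sum_spin_eq_iff {l : ℕ} (x : Fin l → Bool) :
    ∑ i, spin (x i) = (l : ℝ) ↔ ∀ i, x i = true := by
  have h := Finset.sum_eq_sum_iff_of_le fun i (_ : i ∈ univ) => spin_le_one (x i)
  simpa [← spin_eq_one_iff] using h

lemma Hstar_true {l : ℕ} (x y : Fin l → Bool) :
    Hstar l (true, x, y) = 2 * ∑ i, spin (x i) := by
  norm_num [Hstar, show spin true = 1 from if_pos rfl]

lemma Hstar_false {l : ℕ} (x y : Fin l → Bool) :
    Hstar l (false, x, y) = -(2 * ∑ i, spin (y i)) := by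
  norm_num [Hstar, show spin false = -1 by simp [spin]]

lemma neg_le_Hstar {l : ℕ} (σ : Bool × (Fin l → Bool) × (Fin l → Bool)) :
    -(2 * (l : ℝ)) ≤ Hstar l σ := by
  obtain ⟨_ | _, x, y⟩ := σ
  · rw [Hstar_false]
    linarith [sum_spin_le y]
  · rw [Hstar_true]
    linarith [neg_le_sum_spin x]

lemma Hstar_eq_neg_iff {l : ℕ} (σ : Bool × (Fin l → Bool) × (Fin l → Bool)) :
    Hstar l σ = -(2 * (l : ℝ)) ↔
      ((σ.1 = true ∧ ∀ i, σ.2.1 i = false) ∨ (σ.1 = false ∧ ∀ i, σ.2.2 i = true)) := by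
  obtain ⟨_ | _, x, y⟩ := σ
  · simp [Hstar_false, ← sum_spin_eq_iff]
  · rw [Hstar_true, ← mul_neg, mul_right_inj' two_ne_zero, sum_spin_eq_neg_iff]
    simp

lemma card_ground_states (l : ℕ) :
    (Finset.univ.filter (fun σ : Bool × (Fin l → Bool) × (Fin l → Bool) =>
      Hstar l σ = -(2 * (l : ℝ)))).card = 2 ^ (l + 1) := by
  have h : Finset.univ.filter (fun σ : Bool × (Fin l → Bool) × (Fin l → Bool) =>
      Hstar l σ = -(2 * (l : ℝ))) =
      ({true} ×ˢ {fun _ => false} ×ˢ univ) ∪ ({false} ×ˢ univ ×ˢ {fun _ => true}) := by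
    ext ⟨s, x, y⟩
    simp only [mem_filter_univ, Hstar_eq_neg_iff, mem_union, mem_product, mem_singleton,
      mem_univ, funext_iff, true_and, and_true]
  rw [h, card_union_of_disjoint (disjoint_product.2 (Or.inl (by simp)))]
  simp [pow_succ, mul_two]

/-- **Ground states of the star Hamiltonian.**
The minimum of `H_star` over all `2^{2l+1}` configurations equals `-2l`; the
minimizers are exactly the configurations with `s_c = +1` and all `x_i = -1`
(the `y`-spins arbitrary), or `s_c = -1` and all `y_i = +1` (the `x`-spins
arbitrary); in particular there are exactly `2^{l+1}` minimizers. -/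
theorem star_ground_states (l : ℕ) (hl : 1 ≤ l) :
    (∀ σ : Bool × (Fin l → Bool) × (Fin l → Bool), -(2 * (l : ℝ)) ≤ Hstar l σ) ∧
    (∀ σ : Bool × (Fin l → Bool) × (Fin l → Bool),
      Hstar l σ = -(2 * (l : ℝ)) ↔
        ((σ.1 = true ∧ ∀ i, σ.2.1 i = false) ∨
          (σ.1 = false ∧ ∀ i, σ.2.2 i = true))) ∧
    (Finset.univ.filter (fun σ : Bool × (Fin l → Bool) × (Fin l → Bool) =>
        Hstar l σ = -(2 * (l : ℝ)))).card = 2 ^ (l + 1) := by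
  exact ⟨neg_le_Hstar, Hstar_eq_neg_iff, card_ground_states l⟩
end

section
/- Let G = (V, E) be a finite graph with biases h : V → ℝ and couplings J : E → ℝ, defining H_e(s) = Σ_{u ∈ V} h_u·s_u + Σ_{(u,v) ∈ E} J_{uv}·s_u·s_v for s ∈ {−1,+1}^V. Let C ⊆ V be a chain whose intra-chain edges E(C) (edges with both endpoints in C) all have coupling J_{uv} = −λ with λ > 0. Let S ⊆ C be nonempty, let s ∈ {−1,+1}^V, and let s′ be the configuration obtained from s by flipping the sign of every spin in S and leaving all other spins unchanged. Define cut(S, C∖S) as the number of edges of E(C) with one endpoint in S and the other in C∖S, and Vol(S) = Σ_{u ∈ S} (|h_u| + Σ_{v ∉ C, (u,v) ∈ E} |J_{uv}|). If s_u = +1 for all u ∈ S and s_u = −1 for all u ∈ C∖S, then H_e(s′) − H_e(s) ≤ −2·λ·cut(S, C∖S) + 2·Vol(S). -/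
open Finset

/-- Flipping the spins of `S` changes the field term by at most `2 * ∑ u ∈ S, |h u|`. -/
theorem sum_field_flip_sub_le {V : Type*} [Fintype V] [DecidableEq V] (h s : V → ℝ)
    (S : Finset V) (hs : ∀ u ∈ S, |s u| = 1) :
    ∑ u, h u * (if u ∈ S then -s u else s u) - ∑ u, h u * s u ≤ 2 * ∑ u ∈ S, |h u| := by
  rw [← sum_sub_distrib, mul_sum,
    ← sum_subset (subset_univ S) fun u _ hu => by rw [if_neg hu, sub_self]]
  refine sum_le_sum fun u hu => ?_
  have hle : -(h u * s u) ≤ |h u| := by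
    simpa [abs_mul, hs u hu] using neg_le_abs (h u * s u)
  rw [if_pos hu]
  linarith

/-- The energy change of a single coupling `a` when the spins of `S` are flipped. -/
theorem coupling_flip_sub_le {V : Type*} [DecidableEq V] (a lam : ℝ) (e : V × V)
    (C S : Finset V) (hSC : S ⊆ C) (s : V → ℝ) (hs : ∀ u, |s u| = 1)
    (hS1 : ∀ u ∈ S, s u = 1) (hS2 : ∀ u ∈ C \ S, s u = -1)
    (hintra : e.1 ∈ C → e.2 ∈ C → a = -lam) :
    a * (if e.1 ∈ S then -s e.1 else s e.1) * (if e.2 ∈ S then -s e.2 else s e.2) -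
        a * s e.1 * s e.2 ≤
      -2 * lam * (if (e.1 ∈ C ∧ e.2 ∈ C) ∧
          ((e.1 ∈ S ∧ e.2 ∉ S) ∨ (e.2 ∈ S ∧ e.1 ∉ S)) then 1 else 0) +
        2 * ∑ u ∈ S, if (e.1 = u ∧ e.2 ∉ C) ∨ (e.2 = u ∧ e.1 ∉ C) then |a| else 0 := by
  obtain ⟨x, y⟩ := e
  dsimp only at hintra ⊢
  have hnonneg : ∀ u ∈ S,
      0 ≤ if (x = u ∧ y ∉ C) ∨ (y = u ∧ x ∉ C) then |a| else 0 := fun u _ => by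
    split_ifs <;> positivity
  have hsum := sum_nonneg hnonneg
  have hprod : -(a * s x * s y) ≤ |a| := by
    simpa [abs_mul, hs] using neg_le_abs (a * s x * s y)
  by_cases hx : x ∈ S <;> by_cases hy : y ∈ S
  · simp only [hx, hy, not_true_eq_false, and_false, or_self, if_true, if_false]
    linarith
  · by_cases hyC : y ∈ C
    · have ha := hintra (hSC hx) hyC
      have hsy := hS2 y (mem_sdiff.2 ⟨hyC, hy⟩)
      simp only [hx, hy, hSC hx, hyC, hS1 x hx, hsy] at hsum ⊢
      norm_num at hsum ⊢
      linarith
    · have hle := single_le_sum hnonneg hx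
      rw [if_pos (Or.inl ⟨rfl, hyC⟩)] at hle
      rw [if_pos hx, if_neg hy, if_neg fun hc => hyC hc.1.2]
      linarith
  · by_cases hxC : x ∈ C
    · have ha := hintra hxC (hSC hy)
      have hsx := hS2 x (mem_sdiff.2 ⟨hxC, hx⟩)
      simp only [hx, hy, hSC hy, hxC, hS1 y hy, hsx] at hsum ⊢
      norm_num at hsum ⊢
      linarith
    · have hle := single_le_sum hnonneg hy
      rw [if_pos (Or.inr ⟨rfl, hxC⟩)] at hle
      rw [if_neg hx, if_pos hy, if_neg fun hc => hxC hc.1.1]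
      linarith
  · simp only [hx, hy, false_and, and_false, or_self, if_false]
    linarith

/-- **Energy change from flipping one side of a chain break.**
Let `H_e(s) = Σ_u h_u·s_u + Σ_{(u,v)∈E} J_{uv}·s_u·s_v`, let `C` be a chain all
of whose intra-chain edges carry coupling `-λ` with `λ > 0`, and let
`S ⊆ C` be nonempty. If `s ∈ {±1}^V` has `s_u = +1` on `S` and `s_u = -1` on
`C∖S`, and `s'` is obtained from `s` by flipping the spins of `S`, then
`H_e(s') - H_e(s) ≤ -2λ·cut(S, C∖S) + 2·Vol(S)`, where `cut(S, C∖S)` counts the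
intra-chain edges between `S` and `C∖S`, and
`Vol(S) = Σ_{u∈S} (|h_u| + Σ_{v∉C, (u,v)∈E} |J_{uv}|)`. -/
theorem chain_break_flip_energy_bound
    {V : Type*} [Fintype V] [DecidableEq V]
    (E : Finset (V × V)) (h : V → ℝ) (J : V × V → ℝ)
    (C : Finset V) (lam : ℝ) (hlam : 0 < lam)
    (hintra : ∀ e ∈ E, e.1 ∈ C → e.2 ∈ C → J e = -lam)
    (S : Finset V) (hSC : S ⊆ C) (hSne : S.Nonempty)
    (s : V → ℝ) (hs : ∀ u, s u = 1 ∨ s u = -1)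
    (hS1 : ∀ u ∈ S, s u = 1) (hS2 : ∀ u ∈ C \ S, s u = -1) :
    (∑ u, h u * (if u ∈ S then -s u else s u) +
        ∑ e ∈ E, J e * (if e.1 ∈ S then -s e.1 else s e.1) *
          (if e.2 ∈ S then -s e.2 else s e.2)) -
      (∑ u, h u * s u + ∑ e ∈ E, J e * s e.1 * s e.2) ≤
    -2 * lam * ((E.filter (fun e => (e.1 ∈ C ∧ e.2 ∈ C) ∧
          ((e.1 ∈ S ∧ e.2 ∉ S) ∨ (e.2 ∈ S ∧ e.1 ∉ S)))).card : ℝ) +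
      2 * ∑ u ∈ S, (|h u| +
        ∑ e ∈ E.filter (fun e => (e.1 = u ∧ e.2 ∉ C) ∨ (e.2 = u ∧ e.1 ∉ C)), |J e|) := by
  have habs : ∀ u, |s u| = 1 := fun u => by rcases hs u with hu | hu <;> simp [hu]
  have hfield := sum_field_flip_sub_le h s S fun u _ => habs u
  have hcoupling := sum_le_sum fun e he =>
    coupling_flip_sub_le (J e) lam e C S hSC s habs hS1 hS2 (hintra e he)
  rw [sum_sub_distrib, sum_add_distrib, ← mul_sum, ← mul_sum, sum_boole, sum_comm] at hcoupling
  simp only [← sum_filter] at hcoupling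
  rw [sum_add_distrib]
  linarith
end

section
/- Let G = (V, E) be a finite graph with biases h : V → ℝ and couplings J : E → ℝ, defining H_e(s) = Σ_{u ∈ V} h_u·s_u + Σ_{(u,v) ∈ E} J_{uv}·s_u·s_v for s ∈ {−1,+1}^V. Let C₁, …, C_n be pairwise disjoint subsets of V (the chains), each inducing a connected subgraph of G, such that every intra-chain edge (edge with both endpoints in the same C_i) has coupling J_{uv} = −λ with λ > 0. For each chain C_i and each nonempty proper subset S ⊂ C_i, let cut(S, C_i∖S) be the number of intra-chain edges of C_i with one endpoint in S and the other in C_i∖S, and let Vol(S) = Σ_{u ∈ S} (|h_u| + Σ_{v ∉ C_i, (u,v) ∈ E} |J_{uv}|). If for every chain C_i and every nonempty proper subset S ⊂ C_i one has λ·cut(S, C_i∖S) > min(Vol(S), Vol(C_i∖S)), then every global minimizer s of H_e is chain consistent: for each i and all u, v ∈ C_i, s_u = s_v. -/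
open Finset

/-- If flipping the spins of a subset `A` of a chain `C`, across whose boundary in `C` the spins
disagree, does not lower the energy, then the intra-chain cut is bounded by the volume of `A`. -/
lemma lam_mul_cut_le_vol_of_le_flip
    {V : Type*} [Fintype V] [DecidableEq V]
    (E : Finset (V × V)) (h : V → ℝ) (J : V × V → ℝ) (C A : Finset V) (lam : ℝ)
    (hintra : ∀ e ∈ E, e.1 ∈ C → e.2 ∈ C → J e = -lam)
    (s : V → ℝ) (hs : ∀ u, s u = 1 ∨ s u = -1)
    (hAC : A ⊆ C) (hcut : ∀ u ∈ A, ∀ v ∈ C, v ∉ A → s u * s v = -1)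
    (hmin : ∀ t : V → ℝ, (∀ u, t u = 1 ∨ t u = -1) →
      ∑ u, h u * s u + ∑ e ∈ E, J e * s e.1 * s e.2 ≤
        ∑ u, h u * t u + ∑ e ∈ E, J e * t e.1 * t e.2) :
    lam * ((E.filter (fun e => (e.1 ∈ C ∧ e.2 ∈ C) ∧
        ((e.1 ∈ A ∧ e.2 ∉ A) ∨ (e.2 ∈ A ∧ e.1 ∉ A)))).card : ℝ) ≤
      ∑ u ∈ A, (|h u| +
        ∑ e ∈ E.filter (fun e => (e.1 = u ∧ e.2 ∉ C) ∨ (e.2 = u ∧ e.1 ∉ C)), |J e|) := by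
  have abs_mul_spin : ∀ a u, |a * s u| = |a| := by
    intro a u
    rcases hs u with hu | hu <;> simp [hu]
  obtain ⟨t, ht⟩ : ∃ t : V → ℝ, ∀ u, t u = if u ∈ A then -s u else s u := ⟨_, fun _ => rfl⟩
  have key := hmin t (by
    intro u
    rw [ht]
    rcases hs u with hu | hu <;> split_ifs <;> simp [hu])
  have field : ∑ u, h u * t u ≤ ∑ u, h u * s u + 2 * ∑ u ∈ A, |h u| := by
    have hle : ∑ u, h u * t u ≤ ∑ u, (h u * s u + 2 * if u ∈ A then |h u| else 0) := by
      refine Finset.sum_le_sum fun u _ => ?_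
      have := neg_le_abs (h u * s u)
      rw [abs_mul_spin] at this
      rw [ht]
      split_ifs <;> linarith
    rwa [Finset.sum_add_distrib, ← Finset.mul_sum, Finset.sum_ite_mem, Finset.univ_inter] at hle
  have coupling : ∑ e ∈ E, J e * t e.1 * t e.2 ≤ ∑ e ∈ E, (J e * s e.1 * s e.2 +
      2 * (∑ u ∈ A, if (e.1 = u ∧ e.2 ∉ C) ∨ (e.2 = u ∧ e.1 ∉ C) then |J e| else 0) -
      2 * (lam * if (e.1 ∈ C ∧ e.2 ∈ C) ∧ ((e.1 ∈ A ∧ e.2 ∉ A) ∨ (e.2 ∈ A ∧ e.1 ∉ A))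
        then 1 else 0)) := by
    refine Finset.sum_le_sum fun e he => ?_
    have hnonneg : ∀ u ∈ A,
        0 ≤ if (e.1 = u ∧ e.2 ∉ C) ∨ (e.2 = u ∧ e.1 ∉ C) then |J e| else 0 := by
      intro u _
      split_ifs <;> positivity
    have hsum := Finset.sum_nonneg hnonneg
    have hbound : -(J e * s e.1 * s e.2) ≤ |J e| := by
      have := neg_le_abs (J e * s e.1 * s e.2)
      rwa [abs_mul_spin, abs_mul_spin] at this
    rw [ht, ht]
    by_cases h1 : e.1 ∈ A <;> by_cases h2 : e.2 ∈ A
    · simp only [h1, h2, if_true, not_true, and_false, or_false, if_false]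
      linarith
    · by_cases h3 : e.2 ∈ C
      · have hp := hcut _ h1 _ h3 h2
        have hJ := hintra e he (hAC h1) h3
        simp only [h1, h2, h3, hAC h1, if_true, if_false, not_false_eq_true, and_true, true_or]
        simp only [h3, hAC h1, not_true, and_false, or_false, if_false] at hsum ⊢
        rw [hJ]
        linear_combination (2 * lam) * hp + 2 * hsum
      · have := Finset.single_le_sum hnonneg h1
        simp only [h3, not_false_eq_true, and_true, true_or, if_true] at this
        simp only [h1, h2, h3, if_true, if_false, not_false_eq_true, and_true, and_false,
          false_and] at this ⊢
        linarith
    · by_cases h3 : e.1 ∈ C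
      · have hp := hcut _ h2 _ h3 h1
        have hJ := hintra e he h3 (hAC h2)
        simp only [h1, h2, h3, hAC h2, if_true, if_false, not_false_eq_true, and_true, or_true]
        simp only [h3, hAC h2, not_true, and_false, or_false, if_false] at hsum ⊢
        rw [hJ]
        linear_combination (2 * lam) * hp + 2 * hsum
      · have := Finset.single_le_sum hnonneg h2
        simp only [h3, not_false_eq_true, and_true, or_true, if_true] at this
        simp only [h1, h2, h3, if_true, if_false, not_false_eq_true, and_true,
          false_and] at this ⊢
        linarith
    · simp only [h1, h2, if_false, false_and, and_false, or_false]
      linarith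
  rw [Finset.sum_sub_distrib, Finset.sum_add_distrib, ← Finset.mul_sum, ← Finset.mul_sum,
    ← Finset.mul_sum, Finset.sum_boole, Finset.sum_comm] at coupling
  simp only [← Finset.sum_filter] at coupling
  rw [Finset.sum_add_distrib]
  linarith

/-- **Conductance-based sufficient condition for chain consistency of ground
states.** Let `H_e(s) = Σ_u h_u·s_u + Σ_{(u,v)∈E} J_{uv}·s_u·s_v`, with pairwise
disjoint chains `C₁, …, C_n`, each inducing a connected subgraph, and all
intra-chain couplings equal to `-λ` with `λ > 0`. If for every chain `C_i` and
every nonempty proper subset `S ⊂ C_i` one has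
`λ·cut(S, C_i∖S) > min(Vol(S), Vol(C_i∖S))`, then every global minimizer `s` of
`H_e` over `{±1}^V` is chain consistent: `s_u = s_v` for all `u, v` in the same
chain. -/
theorem ground_state_chain_consistency_of_conductance
    {V : Type*} [Fintype V] [DecidableEq V]
    (E : Finset (V × V)) (h : V → ℝ) (J : V × V → ℝ)
    (n : ℕ) (C : Fin n → Finset V) (lam : ℝ) (hlam : 0 < lam)
    (hdisj : ∀ i j, i ≠ j → Disjoint (C i) (C j))
    (hconn : ∀ i, ((SimpleGraph.fromRel
        (fun u v => (u, v) ∈ E ∨ (v, u) ∈ E)).induce (↑(C i) : Set V)).Connected)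
    (hintra : ∀ i, ∀ e ∈ E, e.1 ∈ C i → e.2 ∈ C i → J e = -lam)
    (hcond : ∀ i, ∀ S : Finset V, S ⊆ C i → S.Nonempty → S ≠ C i →
      min (∑ u ∈ S, (|h u| +
            ∑ e ∈ E.filter (fun e => (e.1 = u ∧ e.2 ∉ C i) ∨ (e.2 = u ∧ e.1 ∉ C i)), |J e|))
          (∑ u ∈ C i \ S, (|h u| +
            ∑ e ∈ E.filter (fun e => (e.1 = u ∧ e.2 ∉ C i) ∨ (e.2 = u ∧ e.1 ∉ C i)), |J e|)) <
        lam * ((E.filter (fun e => (e.1 ∈ C i ∧ e.2 ∈ C i) ∧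
            ((e.1 ∈ S ∧ e.2 ∉ S) ∨ (e.2 ∈ S ∧ e.1 ∉ S)))).card : ℝ))
    (s : V → ℝ) (hs : ∀ u, s u = 1 ∨ s u = -1)
    (hmin : ∀ t : V → ℝ, (∀ u, t u = 1 ∨ t u = -1) →
      ∑ u, h u * s u + ∑ e ∈ E, J e * s e.1 * s e.2 ≤
        ∑ u, h u * t u + ∑ e ∈ E, J e * t e.1 * t e.2) :
    ∀ i, ∀ u ∈ C i, ∀ v ∈ C i, s u = s v := by
  intro i
  by_contra! hne
  obtain ⟨u, hu, v, hv, huv⟩ := hne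
  set S := (C i).filter (fun w => s w = s u) with hS
  have hSC : S ⊆ C i := Finset.filter_subset _ _
  have hcut : ∀ a ∈ S, ∀ b ∈ C i, b ∉ S → s a * s b = -1 := by
    intro a ha b hb hbS
    have hab : s a ≠ s b := by
      intro hab
      exact hbS (Finset.mem_filter.2 ⟨hb, hab ▸ (Finset.mem_filter.1 ha).2⟩)
    rcases hs a with h1 | h1 <;> rcases hs b with h2 | h2 <;>
      first | exact absurd (h1.trans h2.symm) hab | simp [h1, h2]
  have hlt := hcond i S hSC ⟨u, by simp [hS, hu]⟩ (by
    intro hEq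
    rw [← hEq] at hv
    exact huv (Finset.mem_filter.1 hv).2.symm)
  have hle := lam_mul_cut_le_vol_of_le_flip E h J (C i) S lam (hintra i) s hs hSC hcut hmin
  have hle' := lam_mul_cut_le_vol_of_le_flip E h J (C i) (C i \ S) lam (hintra i) s hs
    Finset.sdiff_subset (by
      intro a ha b hb hbS
      rw [Finset.mem_sdiff] at ha hbS
      rw [mul_comm]
      exact hcut b (by tauto) a ha.1 ha.2) hmin
  have hsymm : E.filter (fun e => (e.1 ∈ C i ∧ e.2 ∈ C i) ∧
        ((e.1 ∈ C i \ S ∧ e.2 ∉ C i \ S) ∨ (e.2 ∈ C i \ S ∧ e.1 ∉ C i \ S))) =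
      E.filter (fun e => (e.1 ∈ C i ∧ e.2 ∈ C i) ∧
        ((e.1 ∈ S ∧ e.2 ∉ S) ∨ (e.2 ∈ S ∧ e.1 ∉ S))) := by
    refine Finset.filter_congr fun e _ => ?_
    simp only [Finset.mem_sdiff]
    tauto
  rw [hsymm] at hle'
  exact absurd hlt (not_lt.2 (le_min hle hle'))
end
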